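/- arXiv:2405.07312 — 2 statements merged into one kernel-verified Lean document; each statement's English description precedes it below -/
import Mathlib

section
/- Let H, K, L be separable real Hilbert spaces, S : K → L a bounded linear operator, T : H → L a Hilbert–Schmidt operator, and γ > 0. Then the functional G ↦ ‖T − S ∘ G‖²_HS + γ ‖G‖²_HS over all Hilbert–Schmidt operators G : H → K has a unique minimizer, given by G_γ = (S* ∘ S + γ I_K)⁻¹ ∘ S* ∘ T. -/
open RealInnerProductSpace

/-- The closed-form Tikhonov-regularized minimizer `G_γ = (S*S + γI)⁻¹ S* T`. -/
noncomputable def tikhonovMinimizer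
    {H K L : Type*}
    [NormedAddCommGroup H] [InnerProductSpace ℝ H] [CompleteSpace H]
    [NormedAddCommGroup K] [InnerProductSpace ℝ K] [CompleteSpace K]
    [NormedAddCommGroup L] [InnerProductSpace ℝ L] [CompleteSpace L]
    (S : K →L[ℝ] L) (T : H →L[ℝ] L) (γ : ℝ) : H →L[ℝ] K :=
  Ring.inverse (ContinuousLinearMap.adjoint S ∘L S + γ • (1 : K →L[ℝ] K))
    ∘L ContinuousLinearMap.adjoint S ∘L T

/-- `S*S + γI` is invertible for `γ > 0`, since it is bounded below by `γ`. -/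
theorem isUnit_adjoint_comp_self_add_smul_one
    {K L : Type*}
    [NormedAddCommGroup K] [InnerProductSpace ℝ K] [CompleteSpace K]
    [NormedAddCommGroup L] [InnerProductSpace ℝ L] [CompleteSpace L]
    (S : K →L[ℝ] L) {γ : ℝ} (hγ : 0 < γ) :
    IsUnit (ContinuousLinearMap.adjoint S ∘L S + γ • (1 : K →L[ℝ] K)) := by
  refine ContinuousLinearMap.isUnit_of_forall_le_norm_inner_map _
    (c := NNReal.mk γ hγ.le) hγ fun x => ?_
  have h : inner ℝ ((ContinuousLinearMap.adjoint S ∘L S + γ • (1 : K →L[ℝ] K)) x) x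
      = ‖S x‖ ^ 2 + γ * ‖x‖ ^ 2 := by
    simp [inner_add_left, ContinuousLinearMap.adjoint_inner_left, real_inner_smul_left]
  rw [h, Real.norm_of_nonneg (by positivity), NNReal.coe_mk]
  nlinarith [sq_nonneg ‖S x‖]

/-- The normal equation satisfied by the Tikhonov minimizer. -/
theorem adjoint_apply_tikhonovMinimizer
    {H K L : Type*}
    [NormedAddCommGroup H] [InnerProductSpace ℝ H] [CompleteSpace H]
    [NormedAddCommGroup K] [InnerProductSpace ℝ K] [CompleteSpace K]
    [NormedAddCommGroup L] [InnerProductSpace ℝ L] [CompleteSpace L]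
    (S : K →L[ℝ] L) (T : H →L[ℝ] L) {γ : ℝ} (hγ : 0 < γ) (x : H) :
    ContinuousLinearMap.adjoint S (S (tikhonovMinimizer S T γ x))
      + γ • tikhonovMinimizer S T γ x = ContinuousLinearMap.adjoint S (T x) := by
  have h := Ring.mul_inverse_cancel _ (isUnit_adjoint_comp_self_add_smul_one S hγ)
  exact DFunLike.congr_fun h (ContinuousLinearMap.adjoint S (T x))

/-- Completing the square around a solution of the normal equation. -/
theorem tikhonov_objective_eq_add
    {K L : Type*}
    [NormedAddCommGroup K] [InnerProductSpace ℝ K] [CompleteSpace K]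
    [NormedAddCommGroup L] [InnerProductSpace ℝ L] [CompleteSpace L]
    (S : K →L[ℝ] L) {γ : ℝ} {t : L} {g₀ : K}
    (h : ContinuousLinearMap.adjoint S (S g₀) + γ • g₀ = ContinuousLinearMap.adjoint S t)
    (g : K) :
    ‖t - S g‖ ^ 2 + γ * ‖g‖ ^ 2
      = ‖t - S g₀‖ ^ 2 + γ * ‖g₀‖ ^ 2 + (‖S (g - g₀)‖ ^ 2 + γ * ‖g - g₀‖ ^ 2) := by
  obtain ⟨d, rfl⟩ : ∃ d, g = g₀ + d := ⟨g - g₀, by abel⟩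
  have hd : inner ℝ (S g₀) (S d) + γ * inner ℝ g₀ d = inner ℝ t (S d) := by
    simpa [inner_add_left, ContinuousLinearMap.adjoint_inner_left, real_inner_smul_left]
      using congrArg (fun y => inner ℝ y d) h
  rw [map_add, ← sub_sub, norm_sub_sq_real (t - S g₀), norm_add_sq_real, inner_sub_left,
    add_sub_cancel_left]
  linarith

/-- Postcomposition with a bounded operator preserves square-summability. -/
theorem Summable.norm_sq_clm_apply
    {ι E F : Type*}
    [NormedAddCommGroup E] [NormedSpace ℝ E] [NormedAddCommGroup F] [NormedSpace ℝ F]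
    (A : E →L[ℝ] F) {f : ι → E} (hf : Summable fun i => ‖f i‖ ^ 2) :
    Summable fun i => ‖A (f i)‖ ^ 2 := by
  refine (hf.mul_left (‖A‖ ^ 2)).of_nonneg_of_le (fun i => by positivity) fun i => ?_
  rw [← mul_pow]
  gcongr
  exact A.le_opNorm _

/-- Differences of square-summable families are square-summable. -/
theorem Summable.norm_sq_sub
    {ι E : Type*} [NormedAddCommGroup E] {f g : ι → E}
    (hf : Summable fun i => ‖f i‖ ^ 2) (hg : Summable fun i => ‖g i‖ ^ 2) :
    Summable fun i => ‖f i - g i‖ ^ 2 := by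
  refine ((hf.add hg).mul_left 2).of_nonneg_of_le (fun i => by positivity) fun i => ?_
  have h := pow_le_pow_left₀ (norm_nonneg _) (norm_sub_le (f i) (g i)) 2
  nlinarith [sq_nonneg (‖f i‖ - ‖g i‖)]

/-- **Unique regularized risk minimizer** (paper equation (rRM)): for a bounded
`S : K → L`, a Hilbert–Schmidt `T : H → L` (summability of `‖T (b i)‖²` over a Hilbert
basis `b` of `H`) and `γ > 0`, the Tikhonov functional
`G ↦ ‖T − S∘G‖²_HS + γ‖G‖²_HS` over Hilbert–Schmidt operators `G : H → K` has the unique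
minimizer `G_γ = (S*S + γI)⁻¹ S* T`: `G_γ` is Hilbert–Schmidt and every Hilbert–Schmidt
`G ≠ G_γ` has strictly larger objective value. -/
theorem stmt12
    {H K L : Type*}
    [NormedAddCommGroup H] [InnerProductSpace ℝ H] [CompleteSpace H]
    [TopologicalSpace.SeparableSpace H]
    [NormedAddCommGroup K] [InnerProductSpace ℝ K] [CompleteSpace K]
    [TopologicalSpace.SeparableSpace K]
    [NormedAddCommGroup L] [InnerProductSpace ℝ L] [CompleteSpace L]
    [TopologicalSpace.SeparableSpace L]
    {ι : Type*} (b : HilbertBasis ι ℝ H)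
    (S : K →L[ℝ] L) (T : H →L[ℝ] L)
    (hT : Summable fun i => ‖T (b i)‖ ^ 2)
    (γ : ℝ) (hγ : 0 < γ) :
    Summable (fun i => ‖tikhonovMinimizer S T γ (b i)‖ ^ 2) ∧
    ∀ G : H →L[ℝ] K, Summable (fun i => ‖G (b i)‖ ^ 2) → G ≠ tikhonovMinimizer S T γ →
      (∑' i, ‖T (b i) - S (tikhonovMinimizer S T γ (b i))‖ ^ 2)
          + γ * ∑' i, ‖tikhonovMinimizer S T γ (b i)‖ ^ 2
        < (∑' i, ‖T (b i) - S (G (b i))‖ ^ 2) + γ * ∑' i, ‖G (b i)‖ ^ 2 := by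
  have hG₀ : Summable fun i => ‖tikhonovMinimizer S T γ (b i)‖ ^ 2 :=
    Summable.norm_sq_clm_apply
      (Ring.inverse (ContinuousLinearMap.adjoint S ∘L S + γ • (1 : K →L[ℝ] K))
        ∘L ContinuousLinearMap.adjoint S) hT
  refine ⟨hG₀, fun G hG hne => ?_⟩
  obtain ⟨j, hj⟩ : ∃ j, G (b j) ≠ tikhonovMinimizer S T γ (b j) := by
    by_contra! h
    refine hne (ContinuousLinearMap.ext_on
      ((Submodule.dense_iff_topologicalClosure_eq_top).2 b.dense_span) ?_)
    rintro _ ⟨i, rfl⟩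
    exact h i
  have hsq := fun i => tikhonov_objective_eq_add S
    (adjoint_apply_tikhonovMinimizer S T hγ (b i)) (G (b i))
  have hr₀ := hT.norm_sq_sub (hG₀.norm_sq_clm_apply S)
  have hr := hT.norm_sq_sub (hG.norm_sq_clm_apply S)
  rw [← tsum_mul_left, ← tsum_mul_left, ← hr₀.tsum_add (hG₀.mul_left γ),
    ← hr.tsum_add (hG.mul_left γ)]
  refine Summable.tsum_lt_tsum (i := j) (fun i => ?_) ?_ (hr₀.add (hG₀.mul_left γ))
    (hr.add (hG.mul_left γ))
  · rw [hsq i]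
    exact le_add_of_nonneg_right (by positivity)
  · rw [hsq j]
    have : 0 < ‖G (b j) - tikhonovMinimizer S T γ (b j)‖ := norm_pos_iff.2 (sub_ne_zero.2 hj)
    exact lt_add_of_pos_right _ (by positivity)
end

section
/- Let H_Z and H_X be separable real Hilbert spaces. Let Ŝ_Z : H_Z → ℝ^n and Ŝ₊ : H_X → ℝ^n be bounded operators (full-sample sampling operators), and let S̃_Z : H_Z → ℝ^m and S̃₊ : H_X → ℝ^m be bounded operators (subsampling operators). Define the Gram matrices K_Z̃ := S̃_Z S̃_Z* ∈ ℝ^{m×m}, K_∼ := S̃₊ S̃₊* ∈ ℝ^{m×m}, and the cross matrices K_{ZZ̃} := Ŝ_Z S̃_Z* ∈ ℝ^{n×m}, K_{+∼} := Ŝ₊ S̃₊* ∈ ℝ^{n×m}. Let P_Z := S̃_Z* K_Z̃^† S̃_Z and P₊ := S̃₊* K_∼^† S̃₊ be the orthogonal projections onto the closures of the ranges of S̃_Z* and S̃₊* respectively, and fix γ > 0 and n ∈ ℕ. Then the sketched regularized estimator satisfies (P_Z Ŝ_Z* Ŝ_Z P_Z + nγ I)⁻¹ P_Z Ŝ_Z*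 Ŝ₊ P₊ = S̃_Z* (K_{ZZ̃}ᵀ K_{ZZ̃} + nγ K_Z̃)^† K_{ZZ̃}ᵀ K_{+∼} K_∼^† S̃₊ as operators from H_X to H_Z. -/
open RealInnerProductSpace Matrix

/-- The four Moore–Penrose conditions for a pseudoinverse `Md` of a square matrix `M`. -/
def IsMoorePenroseInv {m : ℕ} (M Md : Matrix (Fin m) (Fin m) ℝ) : Prop :=
  M * Md * M = M ∧ Md * M * Md = Md ∧ (M * Md)ᵀ = M * Md ∧ (Md * M)ᵀ = Md * M

/-- If the `K i j` are the matrix entries of `U V*`, then `U V*` acts as multiplication by `K`. -/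
lemma apply_adjoint_eq_mulVec {H : Type*} [NormedAddCommGroup H] [InnerProductSpace ℝ H]
    [CompleteSpace H] {p q : ℕ} {U : H →L[ℝ] EuclideanSpace ℝ (Fin p)}
    {V : H →L[ℝ] EuclideanSpace ℝ (Fin q)} {K : Matrix (Fin p) (Fin q) ℝ}
    (hK : ∀ i j, K i j = U (ContinuousLinearMap.adjoint V (EuclideanSpace.single j 1)) i)
    (v : Fin q → ℝ) :
    U (ContinuousLinearMap.adjoint V (WithLp.toLp 2 v)) = WithLp.toLp 2 (K *ᵥ v) := by
  have hv : WithLp.toLp 2 v = ∑ j, v j • EuclideanSpace.single j (1 : ℝ) := by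
    ext i
    simp [Pi.single_apply]
  ext i
  simp [hv, hK, mulVec, dotProduct, mul_comm]

/-- The entries of `V U*` are those of the transpose of `U V*`. -/
lemma transpose_apply_eq_adjoint {H : Type*} [NormedAddCommGroup H] [InnerProductSpace ℝ H]
    [CompleteSpace H] {p q : ℕ} {U : H →L[ℝ] EuclideanSpace ℝ (Fin p)}
    {V : H →L[ℝ] EuclideanSpace ℝ (Fin q)} {K : Matrix (Fin p) (Fin q) ℝ}
    (hK : ∀ i j, K i j = U (ContinuousLinearMap.adjoint V (EuclideanSpace.single j 1)) i)
    (i : Fin q) (j : Fin p) :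
    Kᵀ i j = V (ContinuousLinearMap.adjoint U (EuclideanSpace.single j 1)) i := by
  have h : ⟪EuclideanSpace.single j (1 : ℝ),
      U (ContinuousLinearMap.adjoint V (EuclideanSpace.single i 1))⟫ =
      ⟪V (ContinuousLinearMap.adjoint U (EuclideanSpace.single j 1)),
        EuclideanSpace.single i (1 : ℝ)⟫ := by
    rw [← ContinuousLinearMap.adjoint_inner_left, ContinuousLinearMap.adjoint_inner_right]
  rw [transpose_apply, hK]
  simpa [EuclideanSpace.inner_single_left, EuclideanSpace.inner_single_right] using h

/-- The quadratic form of the Gram matrix `S S*` is the squared norm of `S* v`. -/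
lemma dotProduct_gram_mulVec {H : Type*} [NormedAddCommGroup H] [InnerProductSpace ℝ H]
    [CompleteSpace H] {m : ℕ} {S : H →L[ℝ] EuclideanSpace ℝ (Fin m)}
    {G : Matrix (Fin m) (Fin m) ℝ}
    (hG : ∀ i j, G i j = S (ContinuousLinearMap.adjoint S (EuclideanSpace.single j 1)) i)
    (v : Fin m → ℝ) :
    v ⬝ᵥ G *ᵥ v = ‖ContinuousLinearMap.adjoint S (WithLp.toLp 2 v)‖ ^ 2 := by
  rw [← real_inner_self_eq_norm_sq, ContinuousLinearMap.adjoint_inner_left,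
    apply_adjoint_eq_mulVec hG, EuclideanSpace.inner_eq_star_dotProduct]
  simp [dotProduct_comm]

/-- A matrix fixed by the Gram matrix `S S*` on the left acts trivially under `S*`. -/
lemma adjoint_mulVec_of_gram_mul {H : Type*} [NormedAddCommGroup H] [InnerProductSpace ℝ H]
    [CompleteSpace H] {m : ℕ} {S : H →L[ℝ] EuclideanSpace ℝ (Fin m)}
    {G : Matrix (Fin m) (Fin m) ℝ}
    (hG : ∀ i j, G i j = S (ContinuousLinearMap.adjoint S (EuclideanSpace.single j 1)) i)
    {M : Matrix (Fin m) (Fin m) ℝ} (hM : G * M = G) (v : Fin m → ℝ) :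
    ContinuousLinearMap.adjoint S (WithLp.toLp 2 (M *ᵥ v)) =
      ContinuousLinearMap.adjoint S (WithLp.toLp 2 v) := by
  have h := dotProduct_gram_mulVec hG (M *ᵥ v - v)
  rw [mulVec_sub, mulVec_mulVec, hM, sub_self, dotProduct_zero, WithLp.toLp_sub, map_sub] at h
  exact sub_eq_zero.1 (norm_eq_zero.1 (pow_eq_zero_iff two_ne_zero |>.1 h.symm))

/-- Adding a nonnegative form to `Cᵀ C` can only shrink the kernel. -/
lemma mul_eq_zero_of_transpose_mul_self_add {n m p : ℕ} {C : Matrix (Fin n) (Fin m) ℝ}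
    {G : Matrix (Fin m) (Fin m) ℝ} (hG : ∀ v, 0 ≤ v ⬝ᵥ G *ᵥ v)
    {M : Matrix (Fin m) (Fin p) ℝ} (h : (Cᵀ * C + G) * M = 0) : C * M = 0 := by
  refine Matrix.ext_of_mulVec_single fun j => ?_
  have h0 : (Cᵀ * C + G) *ᵥ (M *ᵥ Pi.single j 1) = 0 := by rw [mulVec_mulVec, h, zero_mulVec]
  have h1 := congrArg ((M *ᵥ Pi.single j 1) ⬝ᵥ ·) h0
  generalize hw : M *ᵥ Pi.single j 1 = w at h1
  simp only [add_mulVec, dotProduct_add, dotProduct_zero, ← mulVec_mulVec] at h1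
  rw [dotProduct_mulVec w Cᵀ, vecMul_transpose] at h1
  rw [← mulVec_mulVec, hw, zero_mulVec]
  have h2 : 0 ≤ (C *ᵥ w) ⬝ᵥ (C *ᵥ w) := Finset.sum_nonneg fun i _ => mul_self_nonneg _
  exact dotProduct_self_eq_zero.1 (by linarith [hG w])

/-- With `A` the regularised normal matrix, `A A^†` fixes the range of `Cᵀ`. -/
lemma mul_moorePenrose_mul_transpose {n m : ℕ} {C : Matrix (Fin n) (Fin m) ℝ}
    {G Hd : Matrix (Fin m) (Fin m) ℝ} (hG : ∀ v, 0 ≤ v ⬝ᵥ G *ᵥ v) (hGt : Gᵀ = G)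
    (hHd : IsMoorePenroseInv (Cᵀ * C + G) Hd) : (Cᵀ * C + G) * Hd * Cᵀ = Cᵀ := by
  obtain ⟨h1, -, h3, -⟩ := hHd
  set A := Cᵀ * C + G with hA
  have hAt : Aᵀ = A := by simp [hA, hGt]
  have h : A * (A * Hd - 1) = 0 := by
    have := congrArg transpose h1
    rw [transpose_mul, h3, hAt] at this
    rw [mul_sub, this, mul_one, sub_self]
  have hC := mul_eq_zero_of_transpose_mul_self_add hG h
  rw [Matrix.mul_sub, Matrix.mul_one, sub_eq_zero] at hC
  have hCt := congrArg transpose hC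
  rwa [transpose_mul, h3] at hCt

/-- `S* (S S*)^† S` is fixed by `S` on the left. -/
lemma apply_adjoint_moorePenrose {H : Type*} [NormedAddCommGroup H] [InnerProductSpace ℝ H]
    [CompleteSpace H] {m : ℕ} {S : H →L[ℝ] EuclideanSpace ℝ (Fin m)}
    {G Gd : Matrix (Fin m) (Fin m) ℝ}
    (hG : ∀ i j, G i j = S (ContinuousLinearMap.adjoint S (EuclideanSpace.single j 1)) i)
    (hGd : IsMoorePenroseInv G Gd) :
    S ∘L (ContinuousLinearMap.adjoint S ∘L Matrix.toEuclideanCLM (𝕜 := ℝ) Gd ∘L S) = S := by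
  have hGt : Gᵀ = G := by
    ext i j
    rw [transpose_apply_eq_adjoint hG, hG]
  have hM : G * (Gdᵀ * G) = G := by
    have := congrArg transpose hGd.1
    rwa [transpose_mul, transpose_mul, hGt] at this
  ext1 x
  refine ext_inner_left ℝ fun y => ?_
  have h := congrArg (⟪·, x⟫) (adjoint_mulVec_of_gram_mul hG hM (WithLp.ofLp y))
  simp only [ContinuousLinearMap.adjoint_inner_left] at h
  refine Eq.trans ?_ h
  rw [ContinuousLinearMap.comp_apply, ContinuousLinearMap.comp_apply,
    ContinuousLinearMap.comp_apply]
  generalize S x = u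
  obtain ⟨u⟩ := u
  rw [toEuclideanCLM_toLp, apply_adjoint_eq_mulVec hG]
  simp only [EuclideanSpace.inner_eq_star_dotProduct, star_trivial]
  rw [mulVec_mulVec, dotProduct_comm, dotProduct_mulVec, ← mulVec_transpose, transpose_mul, hGt,
    dotProduct_comm]

/-- The operator `S* (S S*)^† S` is self-adjoint. -/
lemma adjoint_moorePenrose_projection {H : Type*} [NormedAddCommGroup H] [InnerProductSpace ℝ H]
    [CompleteSpace H] {m : ℕ} {S : H →L[ℝ] EuclideanSpace ℝ (Fin m)}
    {D : EuclideanSpace ℝ (Fin m) →L[ℝ] EuclideanSpace ℝ (Fin m)}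
    (h : S ∘L (ContinuousLinearMap.adjoint S ∘L D ∘L S) = S) :
    ContinuousLinearMap.adjoint (ContinuousLinearMap.adjoint S ∘L D ∘L S) =
      ContinuousLinearMap.adjoint S ∘L D ∘L S := by
  set P := ContinuousLinearMap.adjoint S ∘L D ∘L S with hP
  have h1 : ContinuousLinearMap.adjoint P ∘L P = ContinuousLinearMap.adjoint P := by
    have : ContinuousLinearMap.adjoint P =
        ContinuousLinearMap.adjoint S ∘L ContinuousLinearMap.adjoint D ∘L S := by
      simp [hP, ContinuousLinearMap.adjoint_comp, ContinuousLinearMap.comp_assoc]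
    rw [this, ContinuousLinearMap.comp_assoc, ContinuousLinearMap.comp_assoc, h]
  have h2 := congrArg ContinuousLinearMap.adjoint h1
  rw [ContinuousLinearMap.adjoint_comp, ContinuousLinearMap.adjoint_adjoint, h1] at h2
  exact h2

/-- The regularised operator `P T* T P + c` is invertible for self-adjoint `P` and `c > 0`. -/
lemma isUnit_sketched_add_smul {H E : Type*} [NormedAddCommGroup H] [InnerProductSpace ℝ H]
    [CompleteSpace H] [NormedAddCommGroup E] [InnerProductSpace ℝ E] [CompleteSpace E]
    {P : H →L[ℝ] H} (hP : ContinuousLinearMap.adjoint P = P) (T : H →L[ℝ] E) {c : ℝ}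
    (hc : 0 < c) :
    IsUnit (P ∘L ContinuousLinearMap.adjoint T ∘L T ∘L P + c • (1 : H →L[ℝ] H)) := by
  refine ContinuousLinearMap.isUnit_of_forall_le_norm_inner_map _ (c := ⟨c, hc.le⟩) hc
    fun x => le_trans ?_ (le_abs_self _)
  have h : ⟪P (ContinuousLinearMap.adjoint T (T (P x))), x⟫ = ‖T (P x)‖ ^ 2 := by
    conv_lhs => rw [← hP]
    rw [ContinuousLinearMap.adjoint_inner_left, ContinuousLinearMap.adjoint_inner_left, hP,
      real_inner_self_eq_norm_sq]
  simp only [_root_.add_apply, ContinuousLinearMap.comp_apply, _root_.smul_apply,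
    _root_.one_apply_eq_self, inner_add_left, real_inner_smul_left, h,
    real_inner_self_eq_norm_sq]
  change ‖x‖ ^ 2 * c ≤ _
  nlinarith [sq_nonneg ‖T (P x)‖]

/-- **Closed form of the Nyström-sketched estimator** (paper Proposition 8).

With full-sample sampling operators `Ŝ_Z : H_Z → ℝⁿ`, `Ŝ₊ : H_X → ℝⁿ` and subsampling
operators `S̃_Z : H_Z → ℝᵐ`, `S̃₊ : H_X → ℝᵐ`, Gram matrices `K_Z̃ = S̃_Z S̃_Z*`,
`K_∼ = S̃₊ S̃₊*`, cross matrices `K_{ZZ̃} = Ŝ_Z S̃_Z*`, `K_{+∼} = Ŝ₊ S̃₊*`, Moore–Penrose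
pseudoinverses thereof, projections `P_Z = S̃_Z* K_Z̃^† S̃_Z`, `P₊ = S̃₊* K_∼^† S̃₊`, and
`γ > 0`, one has
`(P_Z Ŝ_Z*Ŝ_Z P_Z + nγI)⁻¹ P_Z Ŝ_Z* Ŝ₊ P₊
  = S̃_Z* (K_{ZZ̃}ᵀK_{ZZ̃} + nγK_Z̃)^† K_{ZZ̃}ᵀ K_{+∼} K_∼^† S̃₊` as operators `H_X → H_Z`. -/
theorem stmt17
    {HZ HX : Type*}
    [NormedAddCommGroup HZ] [InnerProductSpace ℝ HZ] [CompleteSpace HZ]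
    [TopologicalSpace.SeparableSpace HZ]
    [NormedAddCommGroup HX] [InnerProductSpace ℝ HX] [CompleteSpace HX]
    [TopologicalSpace.SeparableSpace HX]
    (n m : ℕ)
    (SZ : HZ →L[ℝ] EuclideanSpace ℝ (Fin n))
    (Sp : HX →L[ℝ] EuclideanSpace ℝ (Fin n))
    (StZ : HZ →L[ℝ] EuclideanSpace ℝ (Fin m))
    (Stp : HX →L[ℝ] EuclideanSpace ℝ (Fin m))
    (KZt : Matrix (Fin m) (Fin m) ℝ)
    (hKZt : ∀ i j, KZt i j = StZ (ContinuousLinearMap.adjoint StZ (EuclideanSpace.single j 1)) i)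
    (Ktp : Matrix (Fin m) (Fin m) ℝ)
    (hKtp : ∀ i j, Ktp i j = Stp (ContinuousLinearMap.adjoint Stp (EuclideanSpace.single j 1)) i)
    (KZZt : Matrix (Fin n) (Fin m) ℝ)
    (hKZZt : ∀ i j, KZZt i j = SZ (ContinuousLinearMap.adjoint StZ (EuclideanSpace.single j 1)) i)
    (Kpt : Matrix (Fin n) (Fin m) ℝ)
    (hKpt : ∀ i j, Kpt i j = Sp (ContinuousLinearMap.adjoint Stp (EuclideanSpace.single j 1)) i)
    (KZtd : Matrix (Fin m) (Fin m) ℝ) (hKZtd : IsMoorePenroseInv KZt KZtd)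
    (Ktpd : Matrix (Fin m) (Fin m) ℝ) (hKtpd : IsMoorePenroseInv Ktp Ktpd)
    (γ' : ℝ) (hγ : 0 < γ')
    (Hd : Matrix (Fin m) (Fin m) ℝ)
    (hHd : IsMoorePenroseInv (KZZtᵀ * KZZt + ((n : ℝ) * γ') • KZt) Hd) :
    (Ring.inverse
        ((ContinuousLinearMap.adjoint StZ ∘L Matrix.toEuclideanCLM (𝕜 := ℝ) KZtd ∘L StZ)
            ∘L ContinuousLinearMap.adjoint SZ ∘L SZ
            ∘L (ContinuousLinearMap.adjoint StZ ∘L Matrix.toEuclideanCLM (𝕜 := ℝ) KZtd ∘L StZ)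
          + ((n : ℝ) * γ') • (1 : HZ →L[ℝ] HZ))
        ∘L (ContinuousLinearMap.adjoint StZ ∘L Matrix.toEuclideanCLM (𝕜 := ℝ) KZtd ∘L StZ)
        ∘L ContinuousLinearMap.adjoint SZ ∘L Sp
        ∘L (ContinuousLinearMap.adjoint Stp ∘L Matrix.toEuclideanCLM (𝕜 := ℝ) Ktpd ∘L Stp))
      = ContinuousLinearMap.adjoint StZ
          ∘L Matrix.toEuclideanCLM (𝕜 := ℝ) (Hd * KZZtᵀ * Kpt * Ktpd)
          ∘L Stp := by
  rcases Nat.eq_zero_or_pos n with rfl | hn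
  · have hSp : Sp = 0 := Subsingleton.elim _ _
    have hK : Hd * KZZtᵀ * Kpt * Ktpd = 0 := by
      rw [Matrix.mul_assoc Hd, Subsingleton.elim Kpt 0]
      simp
    rw [hSp, hK]
    simp
  have hc : 0 < (n : ℝ) * γ' := by positivity
  have hGt : KZtᵀ = KZt := by
    ext i j
    rw [transpose_apply_eq_adjoint hKZt, hKZt]
  have hpos : ∀ v, 0 ≤ v ⬝ᵥ (((n : ℝ) * γ') • KZt) *ᵥ v := fun v => by
    rw [smul_mulVec, dotProduct_smul, dotProduct_gram_mulVec hKZt, smul_eq_mul]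
    positivity
  have hrange := mul_moorePenrose_mul_transpose hpos (by rw [transpose_smul, hGt]) hHd
  have hunit := isUnit_sketched_add_smul
    (adjoint_moorePenrose_projection (apply_adjoint_moorePenrose hKZt hKZtd)) SZ hc
  have hfix : KZt * (KZtd * KZt) = KZt := by rw [← Matrix.mul_assoc, hKZtd.1]
  have hfactor : ∀ v : Fin n → ℝ,
      (ContinuousLinearMap.adjoint StZ ∘L Matrix.toEuclideanCLM (𝕜 := ℝ) KZtd ∘L StZ)
        (ContinuousLinearMap.adjoint SZ (WithLp.toLp 2 v)) =
      ContinuousLinearMap.adjoint StZ (WithLp.toLp 2 ((KZtd * KZZtᵀ) *ᵥ v)) := fun v => by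
    simp only [ContinuousLinearMap.comp_apply]
    rw [apply_adjoint_eq_mulVec (transpose_apply_eq_adjoint hKZZt), toEuclideanCLM_toLp,
      mulVec_mulVec]
  have hproj : ∀ v : Fin m → ℝ,
      (ContinuousLinearMap.adjoint StZ ∘L Matrix.toEuclideanCLM (𝕜 := ℝ) KZtd ∘L StZ)
        (ContinuousLinearMap.adjoint StZ (WithLp.toLp 2 v)) =
      ContinuousLinearMap.adjoint StZ (WithLp.toLp 2 v) := fun v => by
    simp only [ContinuousLinearMap.comp_apply]
    rw [apply_adjoint_eq_mulVec hKZt, toEuclideanCLM_toLp, mulVec_mulVec,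
      adjoint_mulVec_of_gram_mul hKZt hfix]
  set P := ContinuousLinearMap.adjoint StZ ∘L Matrix.toEuclideanCLM (𝕜 := ℝ) KZtd ∘L StZ with hP
  set B := P ∘L ContinuousLinearMap.adjoint SZ ∘L SZ ∘L P + ((n : ℝ) * γ') • (1 : HZ →L[ℝ] HZ)
    with hB
  have hsolve : ∀ v : Fin n → ℝ, P (ContinuousLinearMap.adjoint SZ (WithLp.toLp 2 v)) =
      B (ContinuousLinearMap.adjoint StZ (WithLp.toLp 2 ((Hd * KZZtᵀ) *ᵥ v))) := fun v => by
    simp only [hB, _root_.add_apply, ContinuousLinearMap.comp_apply, _root_.smul_apply,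
      _root_.one_apply_eq_self]
    rw [hproj, apply_adjoint_eq_mulVec hKZZt, hfactor, hfactor,
      ← adjoint_mulVec_of_gram_mul hKZt hfix ((Hd * KZZtᵀ) *ᵥ v), ← map_smul, ← map_add,
      ← WithLp.toLp_smul, ← WithLp.toLp_add]
    congr 2
    simp only [mulVec_mulVec, ← smul_mulVec, ← add_mulVec]
    congr 1
    nth_rewrite 1 [← hrange]
    simp only [Matrix.mul_add, Matrix.add_mul, Matrix.mul_assoc, Matrix.smul_mul, Matrix.mul_smul]
  ext1 x
  simp only [ContinuousLinearMap.comp_apply]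
  generalize Stp x = u
  obtain ⟨u⟩ := u
  rw [toEuclideanCLM_toLp, toEuclideanCLM_toLp, apply_adjoint_eq_mulVec hKpt, hsolve,
    ← mul_apply_eq_comp, Ring.inverse_mul_cancel _ hunit,
    _root_.one_apply_eq_self]
  simp only [mulVec_mulVec, Matrix.mul_assoc]
end
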